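/- Let τ > √6, let 0 < β < 1/6, and let ρ_min be a minimizing measure with support M. Let γ : (−δ, δ) → S² be a smooth curve parametrized by arc length with γ(0) = p = (1,0,0) and γ'(0) = (0,1,0), and assume that p is a uniform two-sided accumulation point on γ of scaling β. Then M ∩ K(p) ⊆ {q₁, q₂}, where q₁ = (cos θ_max, 0, sin θ_max) and q₂ = (cos θ_max, 0, −sin θ_max). -/

import Mathlib

open MeasureTheory Set
open scoped RealInnerProductSpace ENNReal

noncomputable section

/-- Euclidean three-space. -/
abbrev E3 := EuclideanSpace ℝ (Fin 3)

/-- The unit sphere `S² ⊂ ℝ³`. -/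
def Sphere2 : Set E3 := Metric.sphere 0 1

/-- The function `D(x,y) = (1/4)(1+⟨x,y⟩)(2 − τ²(1−⟨x,y⟩))`. -/
def Dfun (τ : ℝ) (x y : E3) : ℝ :=
  (1 / 4) * (1 + ⟪x, y⟫) * (2 - τ ^ 2 * (1 - ⟪x, y⟫))

/-- The Lagrangian `L = max(0, D)`. -/
def Lfun (τ : ℝ) (x y : E3) : ℝ := max 0 (Dfun τ x y)

/-- The causal action of a measure. -/
def causalAction (τ : ℝ) (ρ : Measure E3) : ℝ :=
  ∫ x, ∫ y, Lfun τ x y ∂ρ ∂ρ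

/-- `ρ` is a minimizing measure: a regular Borel probability measure supported on `S²`
minimizing the causal action among all such measures. -/
def IsMinimizer (τ : ℝ) (ρ : Measure E3) : Prop :=
  IsProbabilityMeasure ρ ∧ ρ.Regular ∧ ρ Sphere2ᶜ = 0 ∧
    ∀ ρ' : Measure E3, IsProbabilityMeasure ρ' → ρ'.Regular → ρ' Sphere2ᶜ = 0 →
      causalAction τ ρ ≤ causalAction τ ρ'

/-- The support of a measure. -/
def msupport (ρ : Measure E3) : Set E3 :=
  {x | ∀ U : Set E3, IsOpen U → x ∈ U → 0 < ρ U}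

/-- The opening angle `θ_max = arccos(1 − 2/τ²)`. -/
def θmax (τ : ℝ) : ℝ := Real.arccos (1 - 2 / τ ^ 2)

/-- The open light cone `I(p)`. -/
def lightConeI (τ : ℝ) (p : E3) : Set E3 := {q ∈ Sphere2 | 0 < Dfun τ p q}

/-- The boundary of the light cone `K(p)`. -/
def lightConeK (τ : ℝ) (p : E3) : Set E3 :=
  {q ∈ Sphere2 | ⟪p, q⟫ = Real.cos (θmax τ)}

/-- Make a point of `ℝ³` from coordinates. -/
def mkE3 (a b c : ℝ) : E3 := (WithLp.equiv 2 (Fin 3 → ℝ)).symm ![a, b, c]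

/-- A totally timelike set. -/
def TotallyTimelike (τ : ℝ) (Ω : Set E3) : Prop := ∀ x ∈ Ω, ∀ y ∈ Ω, 0 < Dfun τ x y

/-- `p` is an accumulation point of `A`: every neighborhood of `p` contains a point
of `A` different from `p`. -/
def AccumulationPt (p : E3) (A : Set E3) : Prop :=
  ∀ U ∈ nhds p, ∃ x ∈ A, x ∈ U ∧ x ≠ p

/-- `γ(0)` is a uniform two-sided accumulation point (of points of `M`) on `γ` of
scaling `β`, where `γ` is defined on `(−δ, δ)`. -/
def UniformTwoSidedAcc (M : Set E3) (β δ : ℝ) (γ : ℝ → E3) : Prop :=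
  ∃ ε₀ : ℝ, 0 < ε₀ ∧ ε₀ < δ ∧ ∀ ε : ℝ, 0 < ε → ε ≤ ε₀ →
    (∃ t ∈ Set.Ioo (-ε) (-(ε ^ (1 + β))), γ t ∈ M) ∧
    (∃ t ∈ Set.Ioo (ε ^ (1 + β)) ε, γ t ∈ M)

/-- The point `q₁ = (cos θ_max, 0, sin θ_max)`. -/
def q1pt (τ : ℝ) : E3 := mkE3 (Real.cos (θmax τ)) 0 (Real.sin (θmax τ))

/-- The point `q₂ = (cos θ_max, 0, −sin θ_max)`. -/
def q2pt (τ : ℝ) : E3 := mkE3 (Real.cos (θmax τ)) 0 (-Real.sin (θmax τ))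

/-- The curve `p_s = (cos s, sin s, 0)` along the equator. -/
def pcurve (s : ℝ) : E3 := mkE3 (Real.cos s) (Real.sin s) 0

/-- Geodesic ball in `S²` of radius `r` around `q`. -/
def geoBall (q : E3) (r : ℝ) : Set E3 := {x ∈ Sphere2 | Real.arccos ⟪q, x⟫ < r}

/-- The set `U_r = (B_r(q₁) ∪ B_r(q₂)) ∖ {q₁, q₂}`. -/
def Uset (τ r : ℝ) : Set E3 := (geoBall (q1pt τ) r ∪ geoBall (q2pt τ) r) \ {q1pt τ, q2pt τ}

/-- The set `I_r(q) = I(q) ∖ U_r`. -/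
def Iset (τ r : ℝ) (q : E3) : Set E3 := lightConeI τ q \ Uset τ r

/-- The point of `S²` with latitude `θ` (measured from the equator) and longitude `φ`. -/
def sphPt (θ φ : ℝ) : E3 :=
  mkE3 (Real.cos θ * Real.cos φ) (Real.cos θ * Real.sin φ) (Real.sin θ)

/-- The restrictions to `Ω` of polynomials of degree at most two on `ℝ³`. -/
def polyRestrictSet (Ω : Set E3) : Set (Ω → ℝ) :=
  {f | ∃ P : MvPolynomial (Fin 3) ℝ, P.totalDegree ≤ 2 ∧
        ∀ x : Ω, f x = MvPolynomial.eval (fun i => (x : E3) i) P}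

/-- The space `K(Ω)` of restrictions to `Ω` of polynomials of degree at most two. -/
def KSpace (Ω : Set E3) : Submodule ℝ (Ω → ℝ) := Submodule.span ℝ (polyRestrictSet Ω)

/-- Two-dimensional Hausdorff (surface) measure on `S²` restricted to `Ω`, as a
measure on `Ω`. -/
def surfΩ (Ω : Set E3) : Measure Ω := Measure.comap Subtype.val (μH[2] : Measure E3)

/-- The bilinear form `B(f,g) = ∫_Ω ∫_Ω D(x,y) f(x) g(y) dμ(x) dμ(y)` on functions on `Ω`. -/
def Bform (τ : ℝ) (Ω : Set E3) (f g : Ω → ℝ) : ℝ :=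
  ∫ x, ∫ y, Dfun τ (x : E3) (y : E3) * f x * g y ∂(surfΩ Ω) ∂(surfΩ Ω)

end

lemma aux_inner (x y : E3) : ⟪x, y⟫ = x 0 * y 0 + x 1 * y 1 + x 2 * y 2 := by
  simp [PiLp.inner_apply, Fin.sum_univ_three]
  ring

lemma aux_Lcont (τ : ℝ) : Continuous (fun z : E3 × E3 => Lfun τ z.1 z.2) := by
  unfold Lfun Dfun
  fun_prop

lemma aux_Lsymm (τ : ℝ) (x y : E3) : Lfun τ x y = Lfun τ y x := by
  unfold Lfun Dfun
  rw [real_inner_comm]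

lemma aux_Lnonneg (τ : ℝ) (x y : E3) : 0 ≤ Lfun τ x y := le_max_left _ _

lemma aux_Lbound (τ : ℝ) (x y : E3) (hx : x ∈ Sphere2) (hy : y ∈ Sphere2) :
    Lfun τ x y ≤ 1 := by
  have hx' : ‖x‖ = 1 := by simpa [Sphere2] using hx
  have hy' : ‖y‖ = 1 := by simpa [Sphere2] using hy
  have h := abs_real_inner_le_norm x y
  rw [hx', hy', abs_le] at h
  unfold Lfun Dfun
  apply max_le (by norm_num)
  nlinarith [mul_nonneg (sq_nonneg τ) (mul_nonneg (sub_nonneg.2 h.2) (by linarith : 0 ≤ 1 + ⟪x, y⟫))]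

/-- integrability of bounded times L -/
lemma aux_int (τ : ℝ) (ρ : Measure E3) [IsProbabilityMeasure ρ] (hs : ρ Sphere2ᶜ = 0)
    (f : E3 × E3 → ℝ) (hf : Measurable f) (C : ℝ) (hC : ∀ z, |f z| ≤ C) :
    Integrable (fun z : E3 × E3 => f z * Lfun τ z.1 z.2) (ρ.prod ρ) := by
  apply Integrable.of_bound (hf.mul (aux_Lcont τ).measurable).aestronglyMeasurable C
  have h1 : ∀ᵐ x ∂ρ, x ∈ Sphere2 := by
    rw [ae_iff]; exact hs
  have h2 : ∀ᵐ z ∂(ρ.prod ρ), z.1 ∈ Sphere2 := Measure.quasiMeasurePreserving_fst.ae h1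
  have h3 : ∀ᵐ z ∂(ρ.prod ρ), z.2 ∈ Sphere2 := Measure.quasiMeasurePreserving_snd.ae h1
  filter_upwards [h2, h3] with z hz1 hz2
  change ‖f z * Lfun τ z.1 z.2‖ ≤ C
  rw [Real.norm_eq_abs, abs_mul, abs_of_nonneg (aux_Lnonneg _ _ _)]
  calc |f z| * Lfun τ z.1 z.2 ≤ |f z| * 1 := by
        gcongr; exact aux_Lbound _ _ _ hz1 hz2
    _ ≤ C := by simpa using hC z

lemma aux_action (τ : ℝ) (ρ : Measure E3) [IsProbabilityMeasure ρ] (hs : ρ Sphere2ᶜ = 0) :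
    causalAction τ ρ = ∫ z, Lfun τ z.1 z.2 ∂(ρ.prod ρ) := by
  have := aux_int τ ρ hs (fun _ => 1) measurable_const 1 (by simp)
  simp only [one_mul] at this
  rw [integral_prod _ this]
  rfl

lemma aux_var (τ : ℝ) (ρ : Measure E3) (hmin : IsMinimizer τ ρ) (w : E3 → ℝ)
    (hw : Measurable w) (h0 : ∀ x, 0 ≤ w x) (C : ℝ) (hC : ∀ x, w x ≤ C) (hW : 0 < ∫ x, w x ∂ρ) :
    causalAction τ ρ * (∫ x, w x ∂ρ) ^ 2 ≤
      ∫ z, (w z.1 * w z.2) * Lfun τ z.1 z.2 ∂(ρ.prod ρ) := by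
  obtain ⟨hp, hr, hs, hm⟩ := hmin
  set W := ∫ x, w x ∂ρ with hWdef
  have hwi : Integrable w ρ := by
    apply Integrable.of_bound hw.aestronglyMeasurable C
    filter_upwards with x
    rw [Real.norm_eq_abs, abs_of_nonneg (h0 x)]
    exact hC x
  let g : E3 → NNReal := fun x => Real.toNNReal (w x / W)
  have hg : Measurable g := (hw.div_const W).real_toNNReal
  have hgc : ∀ x, (g x : ℝ) = w x / W := fun x => Real.coe_toNNReal _ (div_nonneg (h0 x) hW.le)
  let ρ' := ρ.withDensity (fun x => (g x : ℝ≥0∞))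
  have hρ' : ρ' univ = 1 := by
    simp only [ρ']
    rw [withDensity_apply _ MeasurableSet.univ, Measure.restrict_univ]
    have : ∫⁻ x, (g x : ℝ≥0∞) ∂ρ = ENNReal.ofReal (∫ x, w x / W ∂ρ) := by
      rw [ofReal_integral_eq_lintegral_ofReal (hwi.div_const W)]
      · rfl
      · filter_upwards with x using div_nonneg (h0 x) hW.le
    rw [this, integral_div, ← hWdef, div_self hW.ne']
    simp
  have hP : IsProbabilityMeasure ρ' := ⟨hρ'⟩
  have hs' : ρ' Sphere2ᶜ = 0 := withDensity_absolutelyContinuous _ _ hs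
  have key := hm ρ' hP inferInstance hs'
  have e : causalAction τ ρ' = (∫ z, (w z.1 * w z.2) * Lfun τ z.1 z.2 ∂(ρ.prod ρ)) / W ^ 2 := by
    rw [integral_prod _ (aux_int τ ρ hs (fun z => w z.1 * w z.2) (by fun_prop) (C * C) (by
      intro z
      rw [abs_mul, abs_of_nonneg (h0 _), abs_of_nonneg (h0 _)]
      exact mul_le_mul (hC _) (hC _) (h0 _) ((h0 z.1).trans (hC _))))]
    unfold causalAction
    simp only [ρ']
    rw [integral_withDensity_eq_integral_smul hg, ← integral_div]
    congr 1
    ext x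
    rw [integral_withDensity_eq_integral_smul hg]
    simp only [NNReal.smul_def, hgc, smul_eq_mul]
    rw [← integral_const_mul, ← integral_div]
    congr 1
    ext y
    field_simp
  rw [e, le_div_iff₀ (by positivity)] at key
  exact key

lemma aux_pos (τ : ℝ) (ρ : Measure E3) (hmin : IsMinimizer τ ρ) (f : E3 → ℝ)
    (hf : Measurable f) (C : ℝ) (hC : ∀ x, |f x| ≤ C) :
    0 ≤ ∫ z, (f z.1 * f z.2) * Lfun τ z.1 z.2 ∂(ρ.prod ρ) := by
  have hp := hmin.1
  have hs := hmin.2.2.1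
  wlog hC2 : C ≤ 1 / 2 generalizing f C
  · push Not at hC2
    have := this (fun x => f x / (2 * C)) (by fun_prop) (1/2) (by
      intro x
      rw [abs_div, abs_of_pos (by linarith : 0 < 2 * C), div_le_iff₀ (by linarith)]
      linarith [hC x]) le_rfl
    have e : ∀ z : E3 × E3, f z.1 / (2 * C) * (f z.2 / (2 * C)) * Lfun τ z.1 z.2
      = (f z.1 * f z.2 * Lfun τ z.1 z.2) / (2 * C) ^ 2 := by intro z; field_simp
    simp only [e] at this
    rw [integral_div] at this
    by_contra hn
    push Not at hn
    exact absurd this (not_le.2 (div_neg_of_neg_of_pos hn (by nlinarith)))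
  have hfi : Integrable f ρ := Integrable.of_bound hf.aestronglyMeasurable C (by
    filter_upwards with x using hC x)
  have hfb := fun x => abs_le.1 ((hC x).trans hC2)
  have hm : |∫ x, f x ∂ρ| ≤ 1 / 2 := by
    have := norm_integral_le_of_norm_le_const (μ := ρ) (f := f) (C := 1/2)
      (by filter_upwards with x using (hC x).trans hC2)
    simpa using this
  have hm := abs_le.1 hm
  have I1 : ∫ x, (1 + f x) ∂ρ = 1 + ∫ x, f x ∂ρ := by
    rw [integral_add (integrable_const _) hfi]; simp
  have I2 : ∫ x, (1 - f x) ∂ρ = 1 - ∫ x, f x ∂ρ := by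
    rw [integral_sub (integrable_const _) hfi]; simp
  have h1 := aux_var τ ρ hmin (fun x => 1 + f x) (by fun_prop)
    (fun x => by linarith [(hfb x).1]) 2 (fun x => by linarith [(hfb x).2]) (by rw [I1]; linarith)
  have h2 := aux_var τ ρ hmin (fun x => 1 - f x) (by fun_prop)
    (fun x => by linarith [(hfb x).2]) 2 (fun x => by linarith [(hfb x).1]) (by rw [I2]; linarith)
  rw [I1] at h1
  rw [I2] at h2
  have hb : ∀ a b : ℝ, |a| ≤ 2 → |b| ≤ 2 → |a * b| ≤ 4 := by
    intro a b ha hb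
    rw [abs_mul]; nlinarith [abs_nonneg a, abs_nonneg b]
  have i1 := aux_int τ ρ hs (fun z => (1 + f z.1) * (1 + f z.2)) (by fun_prop) 4 (by
    intro z; apply hb <;> rw [abs_le] <;> constructor <;>
      linarith [hfb z.1, hfb z.2, (hfb z.1).1, (hfb z.1).2, (hfb z.2).1, (hfb z.2).2])
  have i2 := aux_int τ ρ hs (fun z => (1 - f z.1) * (1 - f z.2)) (by fun_prop) 4 (by
    intro z; apply hb <;> rw [abs_le] <;> constructor <;>
      linarith [(hfb z.1).1, (hfb z.1).2, (hfb z.2).1, (hfb z.2).2])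
  have i3 := aux_int τ ρ hs (fun z => (f z.1) * (f z.2)) (by fun_prop) 4 (by
    intro z; apply hb <;> rw [abs_le] <;> constructor <;>
      linarith [(hfb z.1).1, (hfb z.1).2, (hfb z.2).1, (hfb z.2).2])
  have i4 := aux_int τ ρ hs (fun z => 1) (by fun_prop) 1 (by simp)
  have hsum := add_le_add h1 h2
  rw [← integral_add i1 i2] at hsum
  have e : ∀ z : E3 × E3, (1 + f z.1) * (1 + f z.2) * Lfun τ z.1 z.2 +
      (1 - f z.1) * (1 - f z.2) * Lfun τ z.1 z.2
      = 2 * (1 * Lfun τ z.1 z.2) + 2 * (f z.1 * f z.2 * Lfun τ z.1 z.2) := by intro z; ring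
  simp only [e] at hsum
  have e2 : ∫ z : E3 × E3, (2 * (1 * Lfun τ z.1 z.2) + 2 * (f z.1 * f z.2 * Lfun τ z.1 z.2)) ∂(ρ.prod ρ)
      = 2 * (∫ z : E3 × E3, 1 * Lfun τ z.1 z.2 ∂(ρ.prod ρ))
        + 2 * ∫ z : E3 × E3, f z.1 * f z.2 * Lfun τ z.1 z.2 ∂(ρ.prod ρ) := by
    rw [integral_add (i4.const_mul 2) (i3.const_mul 2)]
    congr 1
    · exact integral_const_mul _ _
    · exact integral_const_mul _ _
  rw [e2] at hsum
  simp only [one_mul] at hsum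
  rw [← aux_action τ ρ hs] at hsum
  have hS : 0 ≤ causalAction τ ρ := by
    rw [aux_action τ ρ hs]
    exact integral_nonneg (fun z => aux_Lnonneg _ _ _)
  nlinarith [mul_nonneg hS (sq_nonneg (∫ x, f x ∂ρ))]

lemma aux_psd (τ : ℝ) (ρ : Measure E3) (hmin : IsMinimizer τ ρ) (n : ℕ) (x : Fin n → E3)
    (hx : ∀ i, x i ∈ msupport ρ) (c : Fin n → ℝ) :
    0 ≤ ∑ i, ∑ j, c i * c j * Lfun τ (x i) (x j) := by
  have hp := hmin.1
  have hs := hmin.2.2.1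
  apply le_of_forall_pos_le_add
  intro ε hε
  set K := ∑ i, ∑ j, |c i * c j| with hK
  have hK0 : 0 ≤ K := by positivity
  set η := ε / (K + 1) with hη
  have hη0 : 0 < η := by positivity
  have hnb : ∀ i j, ∃ r > 0, ∀ a b, dist a (x i) < r → dist b (x j) < r →
      |Lfun τ a b - Lfun τ (x i) (x j)| < η := by
    intro i j
    obtain ⟨r, hr, h⟩ := Metric.continuousAt_iff.1
      ((aux_Lcont τ).continuousAt (x := (x i, x j))) η hη0
    refine ⟨r, hr, fun a b ha hb => ?_⟩
    have := @h (a, b) (by rw [Prod.dist_eq]; exact max_lt ha hb)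
    rwa [Real.dist_eq] at this
  choose r hr hrb using hnb
  obtain ⟨r0, hr0, hr0b⟩ : ∃ r0 > 0, ∀ i j, r0 ≤ r i j := by
    by_cases hn : Nonempty (Fin n)
    · obtain ⟨p, hp⟩ := Finite.exists_min (fun p : Fin n × Fin n => r p.1 p.2)
      exact ⟨r p.1 p.2, hr _ _, fun i j => hp (i, j)⟩
    · exact ⟨1, one_pos, fun i => (hn ⟨i⟩).elim⟩
  let B : Fin n → Set E3 := fun i => Metric.ball (x i) r0
  have hB : ∀ i, 0 < ρ.real (B i) := by
    intro i
    rw [measureReal_def]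
    exact ENNReal.toReal_pos (hx i _ Metric.isOpen_ball (Metric.mem_ball_self hr0)).ne'
      (measure_ne_top _ _)
  let φ : Fin n → E3 → ℝ := fun i => (B i).indicator (fun _ => (ρ.real (B i))⁻¹)
  have hφm : ∀ i, Measurable (φ i) := fun i =>
    measurable_const.indicator Metric.isOpen_ball.measurableSet
  have hφ0 : ∀ i y, 0 ≤ φ i y := fun i y =>
    indicator_nonneg (fun _ _ => (inv_pos.2 (hB i)).le) y
  have hφ1 : ∀ i, ∫ y, φ i y ∂ρ = 1 := by
    intro i
    simp only [φ]
    rw [integral_indicator_const _ Metric.isOpen_ball.measurableSet, smul_eq_mul]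
    exact mul_inv_cancel₀ (hB i).ne'
  have hφb : ∀ i y, |φ i y| ≤ (ρ.real (B i))⁻¹ := by
    intro i y
    rw [abs_of_nonneg (hφ0 i y)]
    exact indicator_le_self' (fun _ _ => (inv_pos.2 (hB i)).le) y
  have hφi : ∀ i, Integrable (φ i) ρ := fun i =>
    Integrable.of_bound (hφm i).aestronglyMeasurable _ (by filter_upwards with y using hφb i y)
  have hpos := aux_pos τ ρ hmin (fun y => ∑ i, c i * φ i y) (by fun_prop)
    (∑ i, |c i| * (ρ.real (B i))⁻¹) (by
      intro y
      refine (Finset.abs_sum_le_sum_abs _ _).trans (Finset.sum_le_sum fun i _ => ?_)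
      rw [abs_mul]
      exact mul_le_mul_of_nonneg_left (hφb i y) (abs_nonneg _))
  have hij : ∀ i j, Integrable (fun z : E3 × E3 => φ i z.1 * φ j z.2 * Lfun τ z.1 z.2)
      (ρ.prod ρ) := fun i j => aux_int τ ρ hs (fun z => φ i z.1 * φ j z.2)
        (((hφm i).comp measurable_fst).mul ((hφm j).comp measurable_snd))
        ((ρ.real (B i))⁻¹ * (ρ.real (B j))⁻¹) (by
        intro z
        rw [abs_mul]
        exact mul_le_mul (hφb _ _) (hφb _ _) (abs_nonneg _) (inv_pos.2 (hB i)).le)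
  have e : ∀ z : E3 × E3, (∑ i, c i * φ i z.1) * (∑ j, c j * φ j z.2) * Lfun τ z.1 z.2
      = ∑ i, ∑ j, (c i * c j) * (φ i z.1 * φ j z.2 * Lfun τ z.1 z.2) := by
    intro z
    rw [Finset.sum_mul_sum, Finset.sum_mul]
    refine Finset.sum_congr rfl fun i _ => ?_
    rw [Finset.sum_mul]
    refine Finset.sum_congr rfl fun j _ => ?_
    ring
  simp only [e] at hpos
  rw [integral_finsetSum _ (fun i _ => integrable_finsetSum _
    (fun j _ => (hij i j).const_mul _))] at hpos
  have e2 : ∀ i, ∫ z, ∑ j, (c i * c j) * (φ i z.1 * φ j z.2 * Lfun τ z.1 z.2) ∂(ρ.prod ρ)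
      = ∑ j, (c i * c j) * ∫ z, (φ i z.1 * φ j z.2 * Lfun τ z.1 z.2) ∂(ρ.prod ρ) := by
    intro i
    rw [integral_finsetSum _ (fun j _ => (hij i j).const_mul _)]
    refine Finset.sum_congr rfl fun j _ => integral_const_mul _ _
  simp only [e2] at hpos
  have happ : ∀ i j, |(∫ z, (φ i z.1 * φ j z.2 * Lfun τ z.1 z.2) ∂(ρ.prod ρ)) -
      Lfun τ (x i) (x j)| ≤ η := by
    intro i j
    have i0 : Integrable (fun z : E3 × E3 => φ i z.1 * φ j z.2) (ρ.prod ρ) :=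
      (hφi i).mul_prod (hφi j)
    have h1 : ∫ z, φ i z.1 * φ j z.2 ∂(ρ.prod ρ) = 1 := by
      rw [integral_prod_mul, hφ1, hφ1, one_mul]
    have h2 : (∫ z, (φ i z.1 * φ j z.2 * Lfun τ z.1 z.2) ∂(ρ.prod ρ)) - Lfun τ (x i) (x j)
      = ∫ z, (φ i z.1 * φ j z.2 * (Lfun τ z.1 z.2 - Lfun τ (x i) (x j))) ∂(ρ.prod ρ) := by
      simp only [mul_sub]
      rw [integral_sub (hij i j) (i0.mul_const _), integral_mul_const, h1, one_mul]
    rw [h2]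
    calc _ ≤ ∫ z, φ i z.1 * φ j z.2 * η ∂(ρ.prod ρ) := by
          rw [← Real.norm_eq_abs]
          apply norm_integral_le_of_norm_le (i0.mul_const _)
          filter_upwards with z
          have hn : 0 ≤ φ i z.1 * φ j z.2 := mul_nonneg (hφ0 _ _) (hφ0 _ _)
          rw [Real.norm_eq_abs, abs_mul, abs_of_nonneg hn]
          by_cases hz1 : z.1 ∈ B i
          · by_cases hz2 : z.2 ∈ B j
            · exact mul_le_mul_of_nonneg_left (hrb i j _ _ (lt_of_lt_of_le hz1 (hr0b i j))
                (lt_of_lt_of_le hz2 (hr0b i j))).le hn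
            · simp [φ, hz2]
          · simp [φ, hz1]
      _ = η := by rw [integral_mul_const, h1, one_mul]
  have hfin : ∑ i, ∑ j, (c i * c j) * ∫ z, (φ i z.1 * φ j z.2 * Lfun τ z.1 z.2) ∂(ρ.prod ρ)
      ≤ ∑ i, ∑ j, c i * c j * Lfun τ (x i) (x j) + K * η := by
    rw [hK, Finset.sum_mul, ← Finset.sum_add_distrib]
    refine Finset.sum_le_sum fun i _ => ?_
    rw [Finset.sum_mul, ← Finset.sum_add_distrib]
    refine Finset.sum_le_sum fun j _ => ?_
    have h3 : (c i * c j) * ((∫ z, (φ i z.1 * φ j z.2 * Lfun τ z.1 z.2) ∂(ρ.prod ρ)) -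
      Lfun τ (x i) (x j)) ≤ |c i * c j| * η := by
      refine (le_abs_self _).trans ?_
      rw [abs_mul]
      exact mul_le_mul_of_nonneg_left (happ i j) (abs_nonneg _)
    linarith
  have hKη : K * η ≤ ε := by
    rw [hη, mul_div_assoc', div_le_iff₀ (by positivity)]
    nlinarith
  linarith

lemma aux_comb (a b p f s t η : ℝ) (hs : 0 < s) (ht : 0 < t) (hη : 0 ≤ η)
    (h1 : |a - p - f * t| ≤ η * t) (h2 : |b - p + f * s| ≤ η * s) :
    (s * a + t * b - (s + t) * p) ^ 2 ≤ (2 * η * (s * t)) ^ 2 := by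
  rw [sq_le_sq, abs_of_nonneg (by positivity : 0 ≤ 2 * η * (s * t))]
  have e : s * a + t * b - (s + t) * p = s * (a - p - f * t) + t * (b - p + f * s) := by ring
  rw [e]
  refine (abs_add_le _ _).trans ?_
  rw [abs_mul, abs_mul, abs_of_pos hs, abs_of_pos ht]
  have h3 := mul_le_mul_of_nonneg_left h1 hs.le
  have h4 := mul_le_mul_of_nonneg_left h2 ht.le
  linarith

lemma aux_core (τ : ℝ) (ρ : Measure E3) (hmin : IsMinimizer τ ρ) (p x y q : E3)
    (hp : p ∈ msupport ρ) (hx : x ∈ msupport ρ) (hy : y ∈ msupport ρ) (hq : q ∈ msupport ρ)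
    (s t η κ : ℝ) (hs : 0 < s) (ht : 0 < t) (hη : 0 ≤ η) (hκ : 0 < κ)
    (f : Fin 3 → ℝ) (g : Fin 3 → Fin 3 → ℝ)
    (hfx : ∀ k, |x k - p k - f k * t| ≤ η * t) (hfy : ∀ k, |y k - p k + f k * s| ≤ η * s)
    (hgx : ∀ k l, |x k * x l - p k * p l - g k l * t| ≤ η * t)
    (hgy : ∀ k l, |y k * y l - p k * p l + g k l * s| ≤ η * s)
    (hxx : 0 ≤ Dfun τ x x) (hyy : 0 ≤ Dfun τ y y) (hpp : 0 ≤ Dfun τ p p)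
    (hxy : 0 ≤ Dfun τ x y) (hxp : 0 ≤ Dfun τ x p) (hyp : 0 ≤ Dfun τ y p)
    (hqq : Lfun τ q q = 1) (hpq : Lfun τ p q = 0)
    (hxq : κ * t ≤ Lfun τ x q) (hηκ : (6 + 9 * τ ^ 2) * η ^ 2 < κ ^ 2) : False := by
  set b := s * Lfun τ x q + t * Lfun τ y q with hb
  have hbκ : κ * (s * t) ≤ b := by
    have := mul_nonneg ht.le (aux_Lnonneg τ y q)
    nlinarith [mul_le_mul_of_nonneg_left hxq hs.le]
  have key := aux_psd τ ρ hmin 4 ![p, x, y, q]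
    (by intro i; fin_cases i <;> simpa) ![-(s + t), s, t, -b]
  simp only [Fin.sum_univ_four, Matrix.cons_val_zero, Matrix.cons_val_one, Matrix.cons_val] at key
  rw [aux_Lsymm τ p x, aux_Lsymm τ p y, aux_Lsymm τ y x, aux_Lsymm τ q p, aux_Lsymm τ q x,
    aux_Lsymm τ q y, hqq, hpq] at key
  have l : ∀ u v, 0 ≤ Dfun τ u v → Lfun τ u v = Dfun τ u v := fun u v h => max_eq_right h
  rw [l _ _ hxx, l _ _ hyy, l _ _ hpp, l _ _ hxy, l _ _ hxp, l _ _ hyp] at key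
  let X : Fin 3 → ℝ := fun k => s * x k + t * y k - (s + t) * p k
  let Y : Fin 3 → Fin 3 → ℝ := fun k l =>
    s * (x k * x l) + t * (y k * y l) - (s + t) * (p k * p l)
  have hX : ∀ k, X k ^ 2 ≤ (2 * η * (s * t)) ^ 2 := fun k =>
    aux_comb _ _ _ _ s t η hs ht hη (hfx k) (hfy k)
  have hY : ∀ k l, Y k l ^ 2 ≤ (2 * η * (s * t)) ^ 2 := fun k l =>
    aux_comb _ _ _ _ s t η hs ht hη (hgx k l) (hgy k l)
  set A := (s + t) ^ 2 * Dfun τ p p + s ^ 2 * Dfun τ x x + t ^ 2 * Dfun τ y y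
    + 2 * s * t * Dfun τ x y - 2 * s * (s + t) * Dfun τ x p - 2 * t * (s + t) * Dfun τ y p with hA
  have hAe : A = (1 / 4) * (2 * (∑ k, X k ^ 2) + τ ^ 2 * ∑ k, ∑ l, Y k l ^ 2) := by
    simp only [hA, Dfun, aux_inner, Fin.sum_univ_three, X, Y]
    ring
  have hAb : A ≤ (6 + 9 * τ ^ 2) * η ^ 2 * (s * t) ^ 2 := by
    have h1 : ∑ k, X k ^ 2 ≤ 3 * (2 * η * (s * t)) ^ 2 := by
      refine (Finset.sum_le_sum fun k _ => hX k).trans (by simp)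
    have h2 : ∑ k, ∑ l, Y k l ^ 2 ≤ 9 * (2 * η * (s * t)) ^ 2 := by
      refine (Finset.sum_le_sum fun k _ => Finset.sum_le_sum fun l _ => hY k l).trans ?_
      simp only [Finset.sum_const, Finset.card_univ, Fintype.card_fin, nsmul_eq_mul]
      push_cast
      linarith
    rw [hAe]
    have h3 := mul_le_mul_of_nonneg_left h2 (sq_nonneg τ)
    calc _ ≤ (1 / 4) * (2 * (3 * (2 * η * (s * t)) ^ 2) + τ ^ 2 * (9 * (2 * η * (s * t)) ^ 2)) := by
          linarith
      _ = _ := by ring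
  have hAB : b ^ 2 ≤ A := by
    rw [hA]
    have : 0 ≤ A - b ^ 2 := by
      refine key.trans (le_of_eq ?_)
      rw [hA]
      linear_combination 2 * b * hb
    linarith
  have h3 : (κ * (s * t)) ^ 2 ≤ b ^ 2 := pow_le_pow_left₀ (by positivity) hbκ 2
  have h4 : 0 < (s * t) ^ 2 := by positivity
  have h5 := mul_lt_mul_of_pos_right hηκ h4
  have h6 : (κ * (s * t)) ^ 2 = κ ^ 2 * (s * t) ^ 2 := by ring
  linarith

lemma aux_sq (η κ T : ℝ) (hT : 0 < T) (hκ : 0 < κ) (hη : η = κ / (2 * (1 + T))) :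
    T * η ^ 2 < κ ^ 2 := by
  subst hη
  rw [div_pow, mul_div_assoc', div_lt_iff₀ (by positivity)]
  have : 0 < κ ^ 2 := by positivity
  nlinarith [mul_pos this hT, mul_pos (mul_pos this hT) hT]

lemma aux_der (f : ℝ → ℝ) (f' η : ℝ) (hη : 0 < η) (hf : HasDerivAt f f' 0) :
    ∀ᶠ t in nhds (0 : ℝ), |f t - f 0 - f' * t| ≤ η * |t| := by
  have := hf.isLittleO.def hη
  filter_upwards [this] with t ht
  simpa [mul_comm] using ht

/-- Proposition 7.1: if `p = (1,0,0)` is a uniform two-sided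
accumulation point of scaling `β < 1/6` on an arc-length curve `γ` tangent to the
equator, then `M ∩ K(p) ⊆ {q₁, q₂}`. -/
theorem stmt_11 (τ β δ : ℝ) (hτ : Real.sqrt 6 < τ) (hβ0 : 0 < β) (hβ : β < 1 / 6)
    (ρ : Measure E3) (hmin : IsMinimizer τ ρ) (hδ : 0 < δ)
    (γ : ℝ → E3) (hsm : ∀ n : ℕ, ContDiffOn ℝ n γ (Set.Ioo (-δ) δ))
    (hmap : ∀ t ∈ Set.Ioo (-δ) δ, γ t ∈ Sphere2)
    (harc : ∀ t ∈ Set.Ioo (-δ) δ, ‖deriv γ t‖ = 1)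
    (h0 : γ 0 = mkE3 1 0 0) (h1 : deriv γ 0 = mkE3 0 1 0)
    (hacc : UniformTwoSidedAcc (msupport ρ) β δ γ) :
    msupport ρ ∩ lightConeK τ (mkE3 1 0 0) ⊆ {q1pt τ, q2pt τ} := by
  rintro q ⟨hqM, hqS, hqK⟩
  have hτ0 : 0 < τ := (Real.sqrt_nonneg 6).trans_lt hτ
  have hτ6 : 6 < τ ^ 2 := by
    rw [Real.sqrt_lt' hτ0] at hτ
    exact hτ
  have hdiv : 2 / τ ^ 2 < 1 / 3 := by
    rw [div_lt_div_iff₀ (by positivity) (by norm_num)]; linarith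
  have hdiv0 : 0 < 2 / τ ^ 2 := by positivity
  have hcos : Real.cos (θmax τ) = 1 - 2 / τ ^ 2 := by
    unfold θmax
    exact Real.cos_arccos (by linarith) (by linarith)
  have hq0 : q 0 = Real.cos (θmax τ) := by
    rw [← hqK, aux_inner]
    simp [mkE3]
  have hqn : q 0 ^ 2 + q 1 ^ 2 + q 2 ^ 2 = 1 := by
    have : ‖q‖ = 1 := by simpa [Sphere2] using hqS
    have h2 : ⟪q, q⟫ = 1 := by rw [real_inner_self_eq_norm_sq, this]; norm_num
    rw [aux_inner] at h2
    linarith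
  have hDself : ∀ u ∈ Sphere2, Dfun τ u u = 1 := by
    intro u hu
    have : ‖u‖ = 1 := by simpa [Sphere2] using hu
    unfold Dfun
    rw [real_inner_self_eq_norm_sq, this]; norm_num
  by_cases hq1 : q 1 = 0
  · have h2 : q 2 ^ 2 = Real.sin (θmax τ) ^ 2 := by
      rw [Real.sin_sq, ← hq0]
      rw [hq1] at hqn
      linarith
    rcases sq_eq_sq_iff_eq_or_eq_neg.1 h2 with h | h
    · left
      ext i
      fin_cases i <;> simp [q1pt, mkE3, hq0, hq1, h]
    · right
      ext i
      fin_cases i <;> simp [q2pt, mkE3, hq0, hq1, h]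
  exfalso
  have h0mem : (0 : ℝ) ∈ Set.Ioo (-δ) δ := ⟨by linarith, hδ⟩
  have hd : HasDerivAt γ (mkE3 0 1 0) 0 := by
    rw [← h1]
    exact (((hsm 1).contDiffAt (Ioo_mem_nhds h0mem.1 h0mem.2)).differentiableAt (by simp)).hasDerivAt
  have hdk : ∀ k, HasDerivAt (fun t => γ t k) ((mkE3 0 1 0) k) 0 := by
    intro k
    exact (EuclideanSpace.proj (𝕜 := ℝ) k).hasFDerivAt.comp_hasDerivAt (0 : ℝ) hd
  set f : Fin 3 → ℝ := fun k => (mkE3 0 1 0) k with hf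
  set g : Fin 3 → Fin 3 → ℝ := fun k l => f k * γ 0 l + γ 0 k * f l with hg
  have hdg : ∀ k l, HasDerivAt (fun t => γ t k * γ t l) (g k l) 0 := by
    intro k l
    exact (hdk k).mul (hdk l)
  have hdu : HasDerivAt (fun t => ⟪γ t, q⟫) (q 1) 0 := by
    have := (((hdk 0).mul_const (q 0)).add ((hdk 1).mul_const (q 1))).add ((hdk 2).mul_const (q 2))
    have e1 : (fun t => ⟪γ t, q⟫) = ((fun y => γ y 0 * q 0) + fun y => γ y 1 * q 1)
        + fun y => γ y 2 * q 2 := by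
      ext t; rw [aux_inner]; rfl
    have e2 : q 1 = (mkE3 0 1 0) 0 * q 0 + (mkE3 0 1 0) 1 * q 1 + (mkE3 0 1 0) 2 * q 2 := by
      simp [mkE3]
    rw [← e2] at this
    rw [e1]
    exact this
  have hpS : γ 0 ∈ Sphere2 := hmap 0 h0mem
  have hqp : ⟪γ 0, q⟫ = 1 - 2 / τ ^ 2 := by rw [h0, hqK, hcos]
  have hpq : Lfun τ (γ 0) q = 0 := by
    unfold Lfun Dfun
    rw [hqp]
    field_simp
    simp
  have hqq : Lfun τ q q = 1 := by
    unfold Lfun; rw [hDself q hqS]; norm_num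
  have hq1' : 0 < |q 1| := abs_pos.2 hq1
  obtain ⟨κ, hκ⟩ : ∃ κ, κ = τ ^ 2 * |q 1| / 8 := ⟨_, rfl⟩
  have hκ0 : 0 < κ := by rw [hκ]; positivity
  obtain ⟨η, hη⟩ : ∃ η, η = κ / (2 * (1 + (6 + 9 * τ ^ 2))) := ⟨_, rfl⟩
  have hη0 : 0 < η := by rw [hη]; positivity
  have hηκ := aux_sq η κ (6 + 9 * τ ^ 2) (by positivity) hκ0 hη
  have ev1 : ∀ᶠ t in nhds (0 : ℝ), ∀ k, |γ t k - γ 0 k - f k * t| ≤ η * |t| :=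
    Filter.eventually_all.2 fun k => aux_der _ _ η hη0 (hdk k)
  have ev2 : ∀ᶠ t in nhds (0 : ℝ), ∀ k l,
      |γ t k * γ t l - γ 0 k * γ 0 l - g k l * t| ≤ η * |t| :=
    Filter.eventually_all.2 fun k => Filter.eventually_all.2 fun l =>
      aux_der _ _ η hη0 (hdg k l)
  have ev3 : ∀ᶠ t in nhds (0 : ℝ), |⟪γ t, q⟫ - ⟪γ 0, q⟫ - q 1 * t| ≤ (|q 1| / 2) * |t| :=
    aux_der _ _ _ (by positivity) hdu
  obtain ⟨r0, hr0, hD⟩ : ∃ r0 > 0, ∀ u v : E3, dist u (γ 0) < r0 → dist v (γ 0) < r0 →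
      0 ≤ Dfun τ u v := by
    have hc : Continuous (fun z : E3 × E3 => Dfun τ z.1 z.2) := by unfold Dfun; fun_prop
    obtain ⟨r, hr, h⟩ := Metric.continuousAt_iff.1 (hc.continuousAt (x := (γ 0, γ 0))) 1 one_pos
    refine ⟨r, hr, fun a b ha hb => ?_⟩
    have := @h (a, b) (by rw [Prod.dist_eq]; exact max_lt ha hb)
    rw [Real.dist_eq, hDself _ hpS, abs_lt] at this
    linarith [this.1]
  have ev4 : ∀ᶠ t in nhds (0 : ℝ), dist (γ t) (γ 0) < r0 :=
    hd.continuousAt.eventually (Metric.ball_mem_nhds _ hr0)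
  obtain ⟨r, hr, hall⟩ := Metric.eventually_nhds_iff.1 (ev1.and (ev2.and (ev3.and ev4)))
  obtain ⟨ε₀, hε₀, hε₀δ, hac⟩ := hacc
  have hpM : γ 0 ∈ msupport ρ := by
    intro U hU hpU
    obtain ⟨r', hr', hb⟩ := Metric.eventually_nhds_iff.1
      (hd.continuousAt.eventually (hU.mem_nhds hpU))
    obtain ⟨-, t, ht, htM⟩ := hac (min ε₀ r') (lt_min hε₀ hr') (min_le_left _ _)
    refine htM U hU (hb ?_)
    have h1 : 0 < t := (Real.rpow_nonneg (lt_min hε₀ hr').le _).trans_lt ht.1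
    rw [Real.dist_eq, sub_zero, abs_of_pos h1]
    exact ht.2.trans_le (min_le_right _ _)
  have hεp : 0 < min ε₀ r := lt_min hε₀ hr
  obtain ⟨⟨tm, htm, htmM⟩, tp, htp, htpM⟩ := hac (min ε₀ r) hεp (min_le_left _ _)
  have htp0 : 0 < tp := (Real.rpow_nonneg hεp.le _).trans_lt htp.1
  have htm0 : tm < 0 := by
    have := Real.rpow_nonneg hεp.le (1 + β)
    linarith [htm.2]
  have hmr := min_le_right ε₀ r
  obtain ⟨p1, p2, p3, p4⟩ := @hall tp (by
    rw [Real.dist_eq, sub_zero, abs_of_pos htp0]; linarith [htp.2])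
  obtain ⟨m1, m2, m3, m4⟩ := @hall tm (by
    rw [Real.dist_eq, sub_zero, abs_of_neg htm0]; linarith [htm.1])
  rw [abs_of_pos htp0] at p1 p2 p3
  rw [abs_of_neg htm0] at m1 m2 m3
  have p5 : dist (γ 0) (γ 0) < r0 := by simpa using hr0
  have hlow : ∀ t T : ℝ, |q 1| / 2 * T ≤ ⟪γ t, q⟫ - ⟪γ 0, q⟫ → 0 < T →
      κ * T ≤ Lfun τ (γ t) q := by
    intro t T h hT
    refine le_trans ?_ (le_max_right _ _)
    unfold Dfun
    have hpos : 0 < |q 1| / 2 * T := by positivity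
    have e : 2 - τ ^ 2 * (1 - ⟪γ t, q⟫) = τ ^ 2 * (⟪γ t, q⟫ - ⟪γ 0, q⟫) := by
      rw [hqp]; field_simp; ring
    rw [e]
    have hu : 1 ≤ 1 + ⟪γ t, q⟫ := by linarith
    have h3 : τ ^ 2 * (|q 1| / 2 * T) ≤ τ ^ 2 * (⟪γ t, q⟫ - ⟪γ 0, q⟫) :=
      mul_le_mul_of_nonneg_left h (sq_nonneg τ)
    have h4 : 0 < τ ^ 2 * (|q 1| / 2 * T) := by positivity
    have h5 := mul_le_mul hu h3 h4.le (by linarith)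
    rw [hκ]
    linarith
  rcases lt_or_gt_of_ne hq1 with hneg | hpos
  · refine aux_core τ ρ hmin (γ 0) (γ tm) (γ tp) q hpM htmM htpM hqM tp (-tm) η κ htp0
      (by linarith) hη0.le hκ0 (fun k => -f k) (fun k l => -g k l) ?_ ?_ ?_ ?_
      (hD _ _ m4 m4) (hD _ _ p4 p4) (hD _ _ p5 p5) (hD _ _ m4 p4) (hD _ _ m4 p5) (hD _ _ p4 p5)
      hqq hpq (hlow _ _ ?_ (by linarith)) hηκ
    · intro k; simpa using m1 k
    · intro k; simpa [sub_eq_add_neg] using p1 k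
    · intro k l; simpa using m2 k l
    · intro k l; simpa [sub_eq_add_neg] using p2 k l
    · rw [abs_of_neg hneg] at m3 ⊢
      have := (abs_le.1 m3).1
      linarith
  · refine aux_core τ ρ hmin (γ 0) (γ tp) (γ tm) q hpM htpM htmM hqM (-tm) tp η κ
      (by linarith) htp0 hη0.le hκ0 f g p1 ?_ p2 ?_
      (hD _ _ p4 p4) (hD _ _ m4 m4) (hD _ _ p5 p5) (hD _ _ p4 m4) (hD _ _ p4 p5) (hD _ _ m4 p5)
      hqq hpq (hlow _ _ ?_ htp0) hηκ
    · intro k; simpa [sub_eq_add_neg] using m1 k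
    · intro k l; simpa [sub_eq_add_neg] using m2 k l
    · rw [abs_of_pos hpos] at p3 ⊢
      have := (abs_le.1 p3).1
      linarith
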